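/- There exist constants C>0 and h_0>0, depending only on k, α, β, γ, b-a and the quasi-uniformity constant c, such that whenever h ≤ h_0, u is (k+2)-times continuously differentiable with u(a)=u(b)=0, f := -αu''+βu'+γu, and u_h is a Petrov–Galerkin solution, then |(u-u_h)'(gl_{in})| ≤ C h^{k+1} ‖u‖_{k+2,∞} at each of the k-2 interior Lobatto points gl_{in} of every element τ_i. -/

import Mathlib

open Set Finset intervalIntegral

/-- The Legendre polynomial of degree `n` (Rodrigues formula), as a real function. -/
noncomputable def legendre (n : ℕ) : ℝ → ℝ :=
  fun s => (1 / ((2 : ℝ) ^ n * n.factorial)) * iteratedDeriv n (fun t : ℝ => (t ^ 2 - 1) ^ n) s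

/-- The affine map sending `[-1,1]` onto `[p,q]`. -/
noncomputable def affMap (p q s : ℝ) : ℝ := (p + q) / 2 + s * (q - p) / 2

/-- `x 0 = a < x 1 < ... < x N = b` is a partition of `[a,b]`. -/
def IsMesh (a b : ℝ) (N : ℕ) (x : ℕ → ℝ) : Prop :=
  1 ≤ N ∧ x 0 = a ∧ x N = b ∧ ∀ i < N, x i < x (i + 1)

/-- `h` is the maximal element length `h = max_i (x i - x (i-1))`. -/
def IsMeshSize (N : ℕ) (x : ℕ → ℝ) (h : ℝ) : Prop :=
  (∀ i ∈ Finset.Icc 1 N, x i - x (i - 1) ≤ h) ∧ ∃ i ∈ Finset.Icc 1 N, x i - x (i - 1) = h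

/-- Quasi-uniformity with constant `c`: `h ≤ c · h_i` for all elements. -/
def IsQuasiUniform (N : ℕ) (x : ℕ → ℝ) (h c : ℝ) : Prop :=
  ∀ i ∈ Finset.Icc 1 N, h ≤ c * (x i - x (i - 1))

/-- `P i` are the element polynomials (degree ≤ k) of a member of `V_h^0`:
a C¹ piecewise polynomial vanishing at both ends of `[a,b]`. -/
def IsVh0 (k N : ℕ) (x : ℕ → ℝ) (P : ℕ → Polynomial ℝ) : Prop :=
  (∀ i ∈ Finset.Icc 1 N, (P i).natDegree ≤ k) ∧
  (∀ i ∈ Finset.Icc 1 (N - 1), (P i).eval (x i) = (P (i + 1)).eval (x i)) ∧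
  (∀ i ∈ Finset.Icc 1 (N - 1),
      (Polynomial.derivative (P i)).eval (x i) = (Polynomial.derivative (P (i + 1))).eval (x i)) ∧
  (P 1).eval (x 0) = 0 ∧ (P N).eval (x N) = 0

/-- `P i` are the element polynomials of a Petrov–Galerkin solution `u_h ∈ V_h^0`:
`∑_i ∫_{τ_i} (-α u_h'' + β u_h' + γ u_h) v_h = ∫_a^b f v_h` for all `v_h ∈ W_h`. -/
def IsPGSol (k N : ℕ) (x : ℕ → ℝ) (α β γ : ℝ) (f : ℝ → ℝ) (P : ℕ → Polynomial ℝ) : Prop :=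
  IsVh0 k N x P ∧
  ∀ Q : ℕ → Polynomial ℝ, (∀ i ∈ Finset.Icc 1 N, (Q i).natDegree ≤ k - 2) →
    (∑ i ∈ Finset.Icc 1 N, ∫ t in (x (i - 1))..(x i),
        (-α * ((Polynomial.derivative (Polynomial.derivative (P i))).eval t)
            + β * ((Polynomial.derivative (P i)).eval t) + γ * (P i).eval t) * (Q i).eval t)
      = ∑ i ∈ Finset.Icc 1 N, ∫ t in (x (i - 1))..(x i), f t * (Q i).eval t

/-- `P i` are the element polynomials of a Gauss collocation solution `ū_h ∈ V_h^0`: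
`(-α ū_h'' + β ū_h' + γ ū_h)(g) = f(g)` at every Gauss point `g` of every element. -/
def IsGaussSol (k N : ℕ) (x : ℕ → ℝ) (α β γ : ℝ) (f : ℝ → ℝ) (P : ℕ → Polynomial ℝ) : Prop :=
  IsVh0 k N x P ∧
  ∀ i ∈ Finset.Icc 1 N, ∀ s ∈ Set.Ioo (-1 : ℝ) 1, legendre (k - 1) s = 0 →
    -α * ((Polynomial.derivative (Polynomial.derivative (P i))).eval (affMap (x (i - 1)) (x i) s))
        + β * ((Polynomial.derivative (P i)).eval (affMap (x (i - 1)) (x i) s))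
        + γ * (P i).eval (affMap (x (i - 1)) (x i) s)
      = f (affMap (x (i - 1)) (x i) s)

/-- `p` is the elementwise truncated Jacobi projection of `u` on the element `[xl, xr]`:
the polynomial of degree ≤ k matching `u` and `u'` at both endpoints with
`(u - p)'' ⊥ P_{k-2}` in `L²(xl, xr)`. -/
def IsElemProj (k : ℕ) (u : ℝ → ℝ) (xl xr : ℝ) (p : Polynomial ℝ) : Prop :=
  p.natDegree ≤ k ∧ p.eval xl = u xl ∧ p.eval xr = u xr ∧
  (Polynomial.derivative p).eval xl = deriv u xl ∧
  (Polynomial.derivative p).eval xr = deriv u xr ∧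
  ∀ q : Polynomial ℝ, q.natDegree ≤ k - 2 →
    (∫ t in xl..xr,
        (iteratedDeriv 2 u t - (Polynomial.derivative (Polynomial.derivative p)).eval t)
          * q.eval t) = 0

lemma mesh_le_mesh {N : ℕ} {x : ℕ → ℝ} (hx : ∀ i < N, x i < x (i + 1)) {i j : ℕ}
    (hij : i ≤ j) (hj : j ≤ N) : x i ≤ x j := by
  induction j, hij using Nat.le_induction with
  | base => exact le_rfl
  | succ j hij ih => exact (ih (by omega)).trans (hx j (by omega)).le

/-- A continuous, piecewise differentiable function with derivative bounded by `K` deviates from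
its initial value by at most `K` times the distance. -/
lemma abs_sub_le_of_glued {N : ℕ} {x : ℕ → ℝ} (hx : ∀ i < N, x i < x (i + 1))
    {F F' : ℕ → ℝ → ℝ} (hF : ∀ i t, HasDerivAt (F i) (F' i t) t) {K : ℝ}
    (hK : ∀ i ∈ Finset.Icc 1 N, ∀ t ∈ Set.Icc (x (i - 1)) (x i), |F' i t| ≤ K)
    (hglue : ∀ i ∈ Finset.Icc 1 (N - 1), F i (x i) = F (i + 1) (x i)) :
    ∀ i ∈ Finset.Icc 1 N, ∀ t ∈ Set.Icc (x (i - 1)) (x i),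
      |F i t - F 1 (x 0)| ≤ K * (t - x 0) := by
  have step : ∀ i ∈ Finset.Icc 1 N, ∀ t ∈ Set.Icc (x (i - 1)) (x i),
      |F i t - F i (x (i - 1))| ≤ K * (t - x (i - 1)) := by
    intro i hi t ht
    have := Convex.norm_image_sub_le_of_norm_hasDerivWithin_le (f := F i) (f' := F' i)
      (s := Set.Icc (x (i - 1)) (x i)) (C := K) (x := x (i - 1)) (y := t)
      (fun s _ => (hF i s).hasDerivWithinAt) (fun s hs => by simpa using hK i hi s hs)
      (convex_Icc _ _) ⟨le_rfl, ht.1.trans ht.2⟩ ht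
    simpa [Real.norm_eq_abs, abs_of_nonneg (sub_nonneg.2 ht.1)] using this
  intro i hi
  obtain ⟨h1, hN⟩ := Finset.mem_Icc.1 hi
  clear hi
  induction i, h1 using Nat.le_induction with
  | base =>
    intro t ht
    exact step 1 (Finset.mem_Icc.2 ⟨le_rfl, hN⟩) t ht
  | succ i h1 ih =>
    intro t ht
    have hs := step (i + 1) (Finset.mem_Icc.2 ⟨by omega, hN⟩) t ht
    have hx' : x (i - 1) ≤ x i := mesh_le_mesh hx (by omega) (by omega)
    have hi := ih (by omega) (x i) ⟨hx', le_rfl⟩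
    rw [hglue i (Finset.mem_Icc.2 ⟨h1, by omega⟩)] at hi
    simp only [Nat.add_sub_cancel] at hs
    calc |F (i + 1) t - F 1 (x 0)|
        ≤ |F (i + 1) t - F (i + 1) (x i)| + |F (i + 1) (x i) - F 1 (x 0)| := abs_sub_le _ _ _
      _ ≤ K * (t - x i) + K * (x i - x 0) := add_le_add hs hi
      _ = K * (t - x 0) := by ring

lemma exists_characteristic_roots {α β γ : ℝ} (hα : 0 < α) (hγ : 0 ≤ γ) :
    ∃ l m : ℝ, l + m = β / α ∧ l * m = -(γ / α) := by
  have hD : 0 ≤ (β / α) ^ 2 + 4 * (γ / α) := by positivity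
  refine ⟨(β / α + √((β / α) ^ 2 + 4 * (γ / α))) / 2,
    (β / α - √((β / α) ^ 2 + 4 * (γ / α))) / 2, by ring, ?_⟩
  have := Real.sq_sqrt hD
  linear_combination (-1 / 4) * this

set_option maxHeartbeats 1000000 in
/-- Stability of the two-point boundary value problem `-α e'' + β e' + γ e = r` with piecewise
data, measured by the second antiderivative `r₂` of `r`. -/
lemma exists_stability_const {α β γ d : ℝ} (hα : 0 < α) (hγ : 0 ≤ γ) (hd : 0 < d) :
    ∃ C > 0, ∀ (N : ℕ) (x : ℕ → ℝ), 1 ≤ N → x N - x 0 = d → (∀ i < N, x i < x (i + 1)) →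
      ∀ (e e' r r₁ r₂ : ℕ → ℝ → ℝ) (B : ℝ),
        (∀ i t, HasDerivAt (e i) (e' i t) t) →
        (∀ i t, HasDerivAt (e' i) ((β * e' i t + γ * e i t - r i t) / α) t) →
        (∀ i t, HasDerivAt (r₁ i) (r i t) t) →
        (∀ i t, HasDerivAt (r₂ i) (r₁ i t) t) →
        (∀ i ∈ Finset.Icc 1 N, r₁ i (x (i - 1)) = 0 ∧ r₁ i (x i) = 0 ∧
          r₂ i (x (i - 1)) = 0 ∧ r₂ i (x i) = 0) →
        (∀ i ∈ Finset.Icc 1 (N - 1), e i (x i) = e (i + 1) (x i)) →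
        (∀ i ∈ Finset.Icc 1 (N - 1), e' i (x i) = e' (i + 1) (x i)) →
        e 1 (x 0) = 0 → e N (x N) = 0 →
        (∀ i ∈ Finset.Icc 1 N, ∀ t ∈ Set.Icc (x (i - 1)) (x i), |r₂ i t| ≤ B) →
        ∀ i ∈ Finset.Icc 1 N, ∀ t ∈ Set.Icc (x (i - 1)) (x i),
          |e i t| ≤ C * B ∧ |e' i t + r₁ i t / α| ≤ C * B := by
  obtain ⟨l, m, hlm, hlm'⟩ := exists_characteristic_roots (β := β) hα hγ
  set E : ℝ := Real.exp ((|l| + |m|) * d) with hE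
  have hE0 : 0 < E := Real.exp_pos _
  set Φ : ℝ → ℝ := fun t => ∫ s in (0 : ℝ)..t, Real.exp ((l - m) * s) with hΦ
  have hΦd : 0 < Φ d := intervalIntegral_pos_of_pos
    ((by fun_prop : Continuous fun s : ℝ => Real.exp ((l - m) * s)).intervalIntegrable _ _)
    (fun s => Real.exp_pos _) hd
  have hΦ' : ∀ t, HasDerivAt Φ (Real.exp ((l - m) * t)) t := fun t =>
    (by fun_prop : Continuous fun s : ℝ => Real.exp ((l - m) * s)).integral_hasStrictDerivAt 0 t
      |>.hasDerivAt
  have hexp : ∀ y : ℝ, |y| ≤ |l| + |m| → ∀ s, 0 ≤ s → s ≤ d → Real.exp (y * s) ≤ E := by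
    intro y hy s hs hsd
    refine Real.exp_le_exp.2 ?_
    calc y * s ≤ |y| * s := mul_le_mul_of_nonneg_right (le_abs_self y) hs
      _ ≤ (|l| + |m|) * d := mul_le_mul hy hsd hs (by positivity)
  have hΦle : ∀ s, 0 ≤ s → s ≤ d → |Φ s| ≤ E * d := by
    intro s hs hsd
    have := norm_integral_le_of_norm_le_const (a := (0 : ℝ)) (b := s) (C := E)
      (f := fun s => Real.exp ((l - m) * s)) (by
        intro y hy
        rw [uIoc_of_le hs] at hy
        rw [Real.norm_eq_abs, abs_of_pos (Real.exp_pos _)]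
        exact hexp _ (abs_sub _ _) y hy.1.le (hy.2.trans hsd))
    rw [Real.norm_eq_abs, sub_zero, abs_of_nonneg hs] at this
    exact this.trans (mul_le_mul_of_nonneg_left hsd hE0.le)
  obtain ⟨k₁, hk₁⟩ : ∃ y : ℝ, y = l ^ 2 / α * E := ⟨_, rfl⟩
  obtain ⟨k₂, hk₂⟩ : ∃ y : ℝ, y = E * (k₁ * d) + |l + m| / α * E := ⟨_, rfl⟩
  obtain ⟨kω, hkω⟩ : ∃ y : ℝ, y = k₂ * d / Φ d := ⟨_, rfl⟩
  obtain ⟨kv, hkv⟩ : ∃ y : ℝ, y = E * (k₂ * d + kω * (E * d)) + 1 / α := ⟨_, rfl⟩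
  obtain ⟨kw, hkw⟩ : ∃ y : ℝ, y = E * (kω + k₁ * d) + |m| * kv + |l| / α := ⟨_, rfl⟩
  have hk₁0 : 0 ≤ k₁ := by rw [hk₁]; positivity
  have hk₂0 : 0 ≤ k₂ := by rw [hk₂]; positivity
  have hkω0 : 0 ≤ kω := by rw [hkω]; positivity
  have hkv0 : 0 ≤ kv := by rw [hkv]; positivity
  have hkw0 : 0 ≤ kw := by rw [hkw]; positivity
  refine ⟨kv + kw + 1, by positivity, ?_⟩
  intro N x hN hxd hx e e' r r₁ r₂ B he he' hr₁ hr₂ hnode hge hge' he0 heN hB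
  have hB0 : 0 ≤ B := (abs_nonneg _).trans
    (hB 1 (Finset.mem_Icc.2 ⟨le_rfl, hN⟩) (x 0) ⟨le_rfl, (hx 0 (by omega)).le⟩)
  have hrange : ∀ i ∈ Finset.Icc 1 N, ∀ t ∈ Set.Icc (x (i - 1)) (x i),
      0 ≤ t - x 0 ∧ t - x 0 ≤ d := by
    intro i hi t ht
    obtain ⟨h1, h2⟩ := Finset.mem_Icc.1 hi
    have := mesh_le_mesh hx (Nat.zero_le (i - 1)) (by omega)
    have := mesh_le_mesh hx h2 le_rfl
    constructor <;> linarith [ht.1, ht.2]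
  have hβ : β = (l + m) * α := by rw [hlm]; field_simp
  have hγ' : γ = -(l * m) * α := by rw [hlm']; field_simp
  set W : ℕ → ℝ → ℝ := fun i t => e' i t - m * e i t + r₁ i t / α + l * (r₂ i t / α) with hW
  have hexpd : ∀ y t : ℝ, HasDerivAt (fun t => Real.exp (y * (t - x 0)))
      (Real.exp (y * (t - x 0)) * y) t := fun y t => by
    simpa using (((hasDerivAt_id t).sub_const (x 0)).const_mul y).exp
  have hdiv : ∀ i ∈ Finset.Icc 1 N, ∀ t ∈ Set.Icc (x (i - 1)) (x i), |r₂ i t / α| ≤ B / α := by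
    intro i hi t ht
    rw [abs_div, abs_of_pos hα]
    exact div_le_div_of_nonneg_right (hB i hi t ht) hα.le
  have hWd : ∀ i t, HasDerivAt (fun t => W i t * Real.exp (-l * (t - x 0)))
      (-(l ^ 2 * (r₂ i t / α)) * Real.exp (-l * (t - x 0))) t := by
    intro i t
    have := ((((he' i t).sub ((he i t).const_mul m)).add ((hr₁ i t).div_const α)).add
      (((hr₂ i t).div_const α).const_mul l)).mul (hexpd (-l) t)
    refine this.congr_deriv ?_
    simp only [Pi.add_apply, Pi.sub_apply]
    rw [hβ, hγ']
    field_simp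
    ring
  have hnext : ∀ i ∈ Finset.Icc 1 (N - 1), r₁ i (x i) = 0 ∧ r₂ i (x i) = 0 ∧
      r₁ (i + 1) (x i) = 0 ∧ r₂ (i + 1) (x i) = 0 := by
    intro i hi
    obtain ⟨h1, h2⟩ := Finset.mem_Icc.1 hi
    have A := hnode i (Finset.mem_Icc.2 ⟨h1, by omega⟩)
    have A' := hnode (i + 1) (Finset.mem_Icc.2 ⟨by omega, by omega⟩)
    simp only [Nat.add_sub_cancel] at A'
    exact ⟨A.2.1, A.2.2.2, A'.1, A'.2.2.1⟩
  set ω : ℝ := W 1 (x 0) with hω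
  have hWω : ∀ i ∈ Finset.Icc 1 N, ∀ t ∈ Set.Icc (x (i - 1)) (x i),
      |W i t * Real.exp (-l * (t - x 0)) - ω| ≤ k₁ * B * d := by
    intro i hi t ht
    have hK : ∀ i ∈ Finset.Icc 1 N, ∀ t ∈ Set.Icc (x (i - 1)) (x i),
        |(-(l ^ 2 * (r₂ i t / α)) * Real.exp (-l * (t - x 0)))| ≤ k₁ * B := by
      intro i hi t ht
      obtain ⟨h0, h1⟩ := hrange i hi t ht
      have hEE := hexp (-l) (by rw [abs_neg]; linarith [abs_nonneg m]) _ h0 h1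
      rw [abs_mul, abs_neg, abs_mul, abs_of_nonneg (sq_nonneg l), abs_of_pos (Real.exp_pos _)]
      calc l ^ 2 * |r₂ i t / α| * Real.exp (-l * (t - x 0)) ≤ l ^ 2 * (B / α) * E := by
            gcongr
            exact hdiv i hi t ht
        _ = k₁ * B := by rw [hk₁]; ring
    have := abs_sub_le_of_glued hx hWd hK (by
      intro i hi
      obtain ⟨h1, h2, h3, h4⟩ := hnext i hi
      simp only [hW, h1, h2, h3, h4, hge i hi, hge' i hi]) i hi t ht
    obtain ⟨h0, h1⟩ := hrange i hi t ht
    simp only [sub_self, mul_zero, Real.exp_zero, mul_one] at this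
    exact this.trans (mul_le_mul_of_nonneg_left h1 (by positivity))
  have hVd : ∀ i t, HasDerivAt
      (fun t => (e i t + r₂ i t / α) * Real.exp (-m * (t - x 0)) - ω * Φ (t - x 0))
      (Real.exp ((l - m) * (t - x 0)) * (W i t * Real.exp (-l * (t - x 0)) - ω)
        - (l + m) * (r₂ i t / α) * Real.exp (-m * (t - x 0))) t := by
    intro i t
    have h1 : HasDerivAt (fun t => Φ (t - x 0)) (Real.exp ((l - m) * (t - x 0))) t :=
      HasDerivAt.comp_sub_const t (x 0) (hΦ' (t - x 0))
    have := (((he i t).add ((hr₂ i t).div_const α)).mul (hexpd (-m) t)).sub (h1.const_mul ω)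
    refine this.congr_deriv ?_
    have h2 : Real.exp (-m * (t - x 0)) =
        Real.exp ((l - m) * (t - x 0)) * Real.exp (-l * (t - x 0)) := by
      rw [← Real.exp_add]; congr 1; ring
    simp only [hW, Pi.add_apply]
    rw [h2]
    ring
  have hVK : ∀ i ∈ Finset.Icc 1 N, ∀ t ∈ Set.Icc (x (i - 1)) (x i),
      |Real.exp ((l - m) * (t - x 0)) * (W i t * Real.exp (-l * (t - x 0)) - ω)
        - (l + m) * (r₂ i t / α) * Real.exp (-m * (t - x 0))| ≤ k₂ * B := by
    intro i hi t ht
    obtain ⟨h0, h1⟩ := hrange i hi t ht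
    have hE1 := hexp (l - m) (abs_sub _ _) _ h0 h1
    have hE2 := hexp (-m) (by rw [abs_neg]; linarith [abs_nonneg l]) _ h0 h1
    refine (abs_sub _ _).trans ?_
    rw [abs_mul, abs_mul, abs_mul, abs_of_pos (Real.exp_pos _), abs_of_pos (Real.exp_pos _)]
    calc _ ≤ E * (k₁ * B * d) + |l + m| * (B / α) * E := by
          gcongr
          · exact hWω i hi t ht
          · exact hdiv i hi t ht
      _ = k₂ * B := by rw [hk₂]; ring
  have hV : ∀ i ∈ Finset.Icc 1 N, ∀ t ∈ Set.Icc (x (i - 1)) (x i),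
      |(e i t + r₂ i t / α) * Real.exp (-m * (t - x 0)) - ω * Φ (t - x 0)| ≤ k₂ * B * d := by
    intro i hi t ht
    have := abs_sub_le_of_glued hx hVd hVK (by
      intro i hi
      obtain ⟨h1, h2, h3, h4⟩ := hnext i hi
      simp only [h2, h4, hge i hi]) i hi t ht
    obtain ⟨h0, h1⟩ := hrange i hi t ht
    have hr0 : r₂ 1 (x 0) = 0 := (hnode 1 (Finset.mem_Icc.2 ⟨le_rfl, hN⟩)).2.2.1
    have hΦ0 : Φ 0 = 0 := by simp [hΦ]
    simp only [he0, hr0, sub_self, hΦ0, mul_zero, zero_div, add_zero, zero_mul, sub_zero] at this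
    exact this.trans (mul_le_mul_of_nonneg_left h1 (by positivity))
  have hωle : |ω| ≤ kω * B := by
    have hmem : N ∈ Finset.Icc 1 N := Finset.mem_Icc.2 ⟨hN, le_rfl⟩
    have := hV N hmem (x N) ⟨mesh_le_mesh hx (by omega) le_rfl, le_rfl⟩
    rw [heN, (hnode N hmem).2.2.2, hxd, zero_div, add_zero, zero_mul, zero_sub, abs_neg, abs_mul,
      abs_of_pos hΦd] at this
    rw [hkω, div_mul_eq_mul_div, le_div_iff₀ hΦd]
    linarith
  intro i hi t ht
  obtain ⟨h0, h1⟩ := hrange i hi t ht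
  have hcancel : ∀ y : ℝ, Real.exp (-y * (t - x 0)) * Real.exp (y * (t - x 0)) = 1 := by
    intro y
    rw [← Real.exp_add, ← Real.exp_zero]; congr 1; ring
  have hunexp : ∀ y z D : ℝ, |y| ≤ |l| + |m| → |z * Real.exp (-y * (t - x 0))| ≤ D →
      |z| ≤ E * D := by
    intro y z D hy hz
    have : z = Real.exp (y * (t - x 0)) * (z * Real.exp (-y * (t - x 0))) := by
      linear_combination (-z) * hcancel y
    rw [this, abs_mul, abs_of_pos (Real.exp_pos _)]
    exact mul_le_mul (hexp y hy _ h0 h1) hz (abs_nonneg _) hE0.le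
  have hWle : |W i t| ≤ E * (kω + k₁ * d) * B := by
    have := hunexp l (W i t) (|ω| + k₁ * B * d) (by linarith [abs_nonneg m]) (by
      have := abs_sub_abs_le_abs_sub (W i t * Real.exp (-l * (t - x 0))) ω
      linarith [hWω i hi t ht])
    calc |W i t| ≤ E * (|ω| + k₁ * B * d) := this
      _ ≤ E * (kω * B + k₁ * B * d) := by gcongr
      _ = _ := by ring
  have hve : |e i t + r₂ i t / α| ≤ E * (k₂ * d + kω * (E * d)) * B := by
    have := hunexp m (e i t + r₂ i t / α) (|ω * Φ (t - x 0)| + k₂ * B * d)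
      (by linarith [abs_nonneg l]) (by
      have := abs_sub_abs_le_abs_sub ((e i t + r₂ i t / α) * Real.exp (-m * (t - x 0)))
        (ω * Φ (t - x 0))
      linarith [hV i hi t ht])
    calc |e i t + r₂ i t / α| ≤ E * (|ω * Φ (t - x 0)| + k₂ * B * d) := this
      _ ≤ E * (kω * B * (E * d) + k₂ * B * d) := by
          rw [abs_mul]
          gcongr
          exact hΦle _ h0 h1
      _ = _ := by ring
  have hee : |e i t| ≤ kv * B := by
    have h2 := abs_sub (e i t + r₂ i t / α) (r₂ i t / α)
    rw [add_sub_cancel_right] at h2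
    calc |e i t| ≤ _ := h2
      _ ≤ E * (k₂ * d + kω * (E * d)) * B + B / α := add_le_add hve (hdiv i hi t ht)
      _ = kv * B := by rw [hkv, add_mul, one_div, div_eq_inv_mul]
  have hee' : |e' i t + r₁ i t / α| ≤ kw * B := by
    have h2 : e' i t + r₁ i t / α = W i t + m * e i t - l * (r₂ i t / α) := by
      simp only [hW]; ring
    rw [h2]
    calc _ ≤ |W i t| + |m| * |e i t| + |l| * |r₂ i t / α| := by
          refine (abs_sub _ _).trans ?_
          rw [abs_mul l, ← abs_mul m]
          exact add_le_add_left (abs_add_le _ _) _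
      _ ≤ E * (kω + k₁ * d) * B + |m| * (kv * B) + |l| * (B / α) := by
          gcongr
          exact hdiv i hi t ht
      _ = kw * B := by rw [hkw]; ring
  constructor
  · nlinarith
  · nlinarith

lemma exists_sq_eval_le_integral (n : ℕ) : ∃ C > 0, ∀ Q : Polynomial ℝ, Q.natDegree ≤ n →
    ∀ t ∈ Set.Icc (0 : ℝ) 1, (Q.eval t) ^ 2 ≤ C * ∫ s in (0 : ℝ)..1, (Q.eval s) ^ 2 := by
  set f : (Fin (n + 1) → ℝ) → ℝ → ℝ := fun a t => ∑ i, a i * t ^ (i : ℕ) with hf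
  set I : (Fin (n + 1) → ℝ) → ℝ := fun a => ∫ s in (0 : ℝ)..1, f a s ^ 2 with hI
  have hfc : ∀ a, Continuous (f a) := fun a => by simp only [hf]; fun_prop
  have hIc : Continuous I := by
    refine intervalIntegral.continuous_parametric_intervalIntegral_of_continuous' ?_ 0 1
    simp only [hf, Function.uncurry_def]
    fun_prop
  have hIpos : ∀ a, a ≠ 0 → 0 < I a := by
    intro a ha
    refine intervalIntegral.integral_pos one_pos ((hfc a).pow 2).continuousOn
      (fun _ _ => sq_nonneg _) ?_
    by_contra! hcon
    refine ha (funext fun j => ?_)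
    have hP : (∑ i : Fin (n + 1), Polynomial.monomial (i : ℕ) (a i)) = 0 := by
      refine Polynomial.eq_zero_of_infinite_isRoot _
        (Set.Infinite.mono (s := Set.Icc (0 : ℝ) 1) ?_ (Set.Icc_infinite one_pos))
      intro t ht
      have := pow_eq_zero_iff two_ne_zero |>.1 (le_antisymm (hcon t ht) (sq_nonneg (f a t)))
      simpa [Polynomial.IsRoot, Polynomial.eval_finsetSum, hf] using this
    have := congrArg (fun p => Polynomial.coeff p (j : ℕ)) hP
    simpa [Polynomial.coeff_monomial, Fin.val_inj] using this
  obtain ⟨a₀, ha₀, hmin⟩ := (isCompact_sphere (0 : Fin (n + 1) → ℝ) 1).exists_isMinOn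
    (NormedSpace.sphere_nonempty.2 zero_le_one) hIc.continuousOn
  have hμ : 0 < I a₀ := hIpos a₀ (by
    rintro rfl
    simp at ha₀)
  have hlow : ∀ a, I a₀ * ‖a‖ ^ 2 ≤ I a := by
    intro a
    rcases eq_or_ne a 0 with rfl | ha
    · simp [hI, hf]
    · have hna : 0 < ‖a‖ := norm_pos_iff.2 ha
      have h1 : I a₀ ≤ I (‖a‖⁻¹ • a) := hmin (by simp [norm_smul, hna.ne'])
      have h2 : I (‖a‖⁻¹ • a) = (‖a‖⁻¹) ^ 2 * I a := by
        simp only [hI]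
        rw [← intervalIntegral.integral_const_mul]
        refine intervalIntegral.integral_congr fun s _ => ?_
        simp only [hf, Pi.smul_apply, smul_eq_mul, mul_assoc, ← Finset.mul_sum, mul_pow]
      calc I a₀ * ‖a‖ ^ 2 ≤ (‖a‖⁻¹) ^ 2 * I a * ‖a‖ ^ 2 := by
            gcongr
            exact h1.trans_eq h2
        _ = I a := by field_simp
  refine ⟨(n + 1) ^ 2 / I a₀, by positivity, fun Q hQ t ht => ?_⟩
  have hQf : ∀ s, Q.eval s = f (fun i => Q.coeff i) s := by
    intro s
    rw [Polynomial.eval_eq_sum_range' (Nat.lt_succ_of_le hQ)]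
    exact (Fin.sum_univ_eq_sum_range (fun i => Q.coeff i * s ^ i) (n + 1)).symm
  have habs : |Q.eval t| ≤ (n + 1) * ‖fun i : Fin (n + 1) => Q.coeff i‖ := by
    rw [hQf]
    calc _ ≤ ∑ i : Fin (n + 1), |Q.coeff i * t ^ (i : ℕ)| := Finset.abs_sum_le_sum_abs _ _
      _ ≤ ∑ _i : Fin (n + 1), ‖fun i : Fin (n + 1) => Q.coeff i‖ := by
          refine Finset.sum_le_sum fun i _ => ?_
          rw [abs_mul, abs_of_nonneg (pow_nonneg ht.1 _)]
          calc |Q.coeff i| * t ^ (i : ℕ) ≤ |Q.coeff i| * 1 :=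
                mul_le_mul_of_nonneg_left (pow_le_one₀ ht.1 ht.2) (abs_nonneg _)
            _ ≤ _ := by
                rw [mul_one]
                exact norm_le_pi_norm (fun i : Fin (n + 1) => Q.coeff i) i
      _ = _ := by simp
  have hint : ∫ s in (0 : ℝ)..1, (Q.eval s) ^ 2 = I (fun i => Q.coeff i) := by
    simp only [hI, hQf]
  rw [hint, div_mul_eq_mul_div, le_div_iff₀ hμ]
  have hsq : (Q.eval t) ^ 2 ≤ ((n + 1) * ‖fun i : Fin (n + 1) => Q.coeff i‖) ^ 2 := by
    rw [← sq_abs]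
    gcongr
  calc (Q.eval t) ^ 2 * I a₀ ≤ ((n + 1) * ‖fun i : Fin (n + 1) => Q.coeff i‖) ^ 2 * I a₀ := by
        gcongr
    _ = (n + 1) ^ 2 * (I a₀ * ‖fun i : Fin (n + 1) => Q.coeff i‖ ^ 2) := by ring
    _ ≤ _ := by
        gcongr
        exact hlow _

/-- The `L²` projection onto polynomials of degree at most `n` is bounded in the supremum norm,
uniformly in the interval. -/
lemma exists_projection_bound (n : ℕ) : ∃ C > 0, ∀ p q : ℝ, p < q → ∀ (G : ℝ → ℝ)
    (Q : Polynomial ℝ) (D : ℝ), Continuous G → Q.natDegree ≤ n →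
    (∀ v : Polynomial ℝ, v.natDegree ≤ n → ∫ t in p..q, (G t - Q.eval t) * v.eval t = 0) →
    (∀ t ∈ Set.Icc p q, |G t| ≤ D) → ∀ t ∈ Set.Icc p q, |Q.eval t| ≤ C * D := by
  obtain ⟨C, hC, hCQ⟩ := exists_sq_eval_le_integral n
  refine ⟨C, hC, fun p q hpq G Q D hG hQ horth hGD => ?_⟩
  have hl : 0 < q - p := sub_pos.2 hpq
  have hQc : Continuous fun t => Q.eval t := Q.continuous
  obtain ⟨t₀, ht₀, hmax⟩ := isCompact_Icc.exists_isMaxOn (Set.nonempty_Icc.2 hpq.le)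
    (hQc.abs.continuousOn (s := Set.Icc p q))
  have hmax' : ∀ t ∈ Set.Icc p q, |Q.eval t| ≤ |Q.eval t₀| := fun t ht => hmax ht
  have hD0 : 0 ≤ D := (abs_nonneg _).trans (hGD t₀ ht₀)
  have hscale : (Q.eval t₀) ^ 2 ≤ C * ((q - p)⁻¹ * ∫ t in p..q, (Q.eval t) ^ 2) := by
    have h1 := hCQ (Q.comp (Polynomial.C p + Polynomial.C (q - p) * Polynomial.X)) (by
        refine (Polynomial.natDegree_comp_le).trans ?_
        refine (Nat.mul_le_mul hQ (?_ : _ ≤ 1)).trans_eq (mul_one n)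
        compute_degree) ((t₀ - p) / (q - p))
      ⟨div_nonneg (by linarith [ht₀.1]) hl.le, (div_le_one hl).2 (by linarith [ht₀.2])⟩
    simp only [Polynomial.eval_comp, Polynomial.eval_add, Polynomial.eval_mul, Polynomial.eval_C,
      Polynomial.eval_X] at h1
    rw [mul_div_cancel₀ _ hl.ne', intervalIntegral.integral_comp_add_mul
      (fun t => (Q.eval t) ^ 2) hl.ne' p] at h1
    simpa using h1
  have hQQ : ∫ t in p..q, (Q.eval t) ^ 2 = ∫ t in p..q, G t * Q.eval t := by
    have h1 := horth Q hQ
    simp only [sub_mul, ← pow_two] at h1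
    rw [intervalIntegral.integral_sub (f := fun t => G t * Q.eval t)
      (g := fun t => Q.eval t ^ 2) ((hG.mul hQc).intervalIntegrable _ _)
      ((hQc.pow 2).intervalIntegrable _ _)] at h1
    linarith
  have hGQ : ∫ t in p..q, G t * Q.eval t ≤ D * |Q.eval t₀| * (q - p) := by
    have := norm_integral_le_of_norm_le_const (a := p) (b := q) (C := D * |Q.eval t₀|)
      (f := fun t => G t * Q.eval t) (by
        intro t ht
        rw [uIoc_of_le hpq.le] at ht
        have ht' := Set.Ioc_subset_Icc_self ht
        rw [Real.norm_eq_abs, abs_mul]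
        exact mul_le_mul (hGD t ht') (hmax' t ht') (abs_nonneg _) hD0)
    rw [abs_of_pos hl] at this
    exact (le_abs_self _).trans this
  have hmain : |Q.eval t₀| * |Q.eval t₀| ≤ C * D * |Q.eval t₀| := by
    calc |Q.eval t₀| * |Q.eval t₀| = (Q.eval t₀) ^ 2 := by rw [← pow_two, sq_abs]
      _ ≤ C * ((q - p)⁻¹ * ∫ t in p..q, (Q.eval t) ^ 2) := hscale
      _ ≤ C * ((q - p)⁻¹ * (D * |Q.eval t₀| * (q - p))) := by
          rw [hQQ]
          gcongr
      _ = C * D * |Q.eval t₀| := by field_simp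
  intro t ht
  refine (hmax' t ht).trans ?_
  rcases (abs_nonneg (Q.eval t₀)).eq_or_lt with h0 | h0
  · rw [← h0]; positivity
  · exact le_of_mul_le_mul_right hmain h0

/-- Taylor approximation by a polynomial of degree at most `n`. -/
lemma exists_taylor_polynomial {f : ℝ → ℝ} {n : ℕ} {p q M : ℝ} (hpq : p < q)
    (hf : ContDiff ℝ (n + 1) f) (hM : ∀ y ∈ Set.Icc p q, |iteratedDeriv (n + 1) f y| ≤ M) :
    ∃ T : Polynomial ℝ, T.natDegree ≤ n ∧
      ∀ t ∈ Set.Icc p q, |f t - T.eval t| ≤ M * (q - p) ^ (n + 1) := by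
  refine ⟨∑ j ∈ Finset.range (n + 1), Polynomial.C (((j.factorial : ℝ)⁻¹) *
    iteratedDerivWithin j f (Set.Icc p q) p) * (Polynomial.X - Polynomial.C p) ^ j, ?_, ?_⟩
  · refine Polynomial.natDegree_sum_le_of_forall_le _ _ fun j hj => ?_
    refine (Polynomial.natDegree_C_mul_le _ _).trans ?_
    rw [Polynomial.natDegree_pow, Polynomial.natDegree_X_sub_C]
    have := Finset.mem_range.1 hj
    omega
  · intro t ht
    have hM0 : 0 ≤ M := (abs_nonneg _).trans (hM t ht)
    have h1 := taylor_mean_remainder_bound (C := M) hpq.le hf.contDiffOn ht (by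
      intro y hy
      rw [iteratedDerivWithin_eq_iteratedDeriv (uniqueDiffOn_Icc hpq)
        (by exact_mod_cast hf.contDiffAt) hy]
      exact hM y hy)
    rw [taylor_within_apply, Real.norm_eq_abs] at h1
    have h2 : (∑ j ∈ Finset.range (n + 1), Polynomial.C (((j.factorial : ℝ)⁻¹) *
        iteratedDerivWithin j f (Set.Icc p q) p) * (Polynomial.X - Polynomial.C p) ^ j).eval t
        = ∑ j ∈ Finset.range (n + 1), ((j.factorial : ℝ)⁻¹ * (t - p) ^ j) •
          iteratedDerivWithin j f (Set.Icc p q) p := by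
      rw [Polynomial.eval_finsetSum]
      refine Finset.sum_congr rfl fun j _ => ?_
      simp
      ring
    rw [h2]
    have h0 : 0 ≤ t - p := sub_nonneg.2 ht.1
    calc _ ≤ _ := h1
      _ ≤ M * (t - p) ^ (n + 1) := div_le_self (by positivity)
          (by exact_mod_cast Nat.one_le_iff_ne_zero.2 (Nat.factorial_ne_zero n))
      _ ≤ M * (q - p) ^ (n + 1) := by
          gcongr
          exact ht.2

open Polynomial in
/-- The polynomial `((X - p)(X - q))ⁿ`, whose `n`-th derivative is a multiple of the Legendre
polynomial of the interval `[p, q]`. -/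
noncomputable def bubblePow (n : ℕ) (p q : ℝ) : Polynomial ℝ := ((X - C p) * (X - C q)) ^ n

open Polynomial in
lemma monic_and_natDegree_bubblePow (n : ℕ) (p q : ℝ) :
    (bubblePow n p q).Monic ∧ (bubblePow n p q).natDegree = 2 * n := by
  have hm : ((X - C p) * (X - C q) : ℝ[X]).Monic := (monic_X_sub_C p).mul (monic_X_sub_C q)
  refine ⟨hm.pow n, ?_⟩
  rw [bubblePow, hm.natDegree_pow, (monic_X_sub_C p).natDegree_mul (monic_X_sub_C q)]
  simp only [natDegree_X_sub_C]
  ring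

open Polynomial in
lemma bubblePow_derivative_identity (n m : ℕ) (p q : ℝ) :
    ((X - C p) * (X - C q)) * derivative^[m + 2] (bubblePow n p q)
      + ((m : ℝ[X]) + 1) * (2 * X - C p - C q) * derivative^[m + 1] (bubblePow n p q)
      + (m : ℝ[X]) * ((m : ℝ[X]) + 1) * derivative^[m] (bubblePow n p q)
    = (n : ℝ[X]) * (2 * X - C p - C q) * derivative^[m + 1] (bubblePow n p q)
      + 2 * (n : ℝ[X]) * ((m : ℝ[X]) + 1) * derivative^[m] (bubblePow n p q) := by
  induction m with
  | zero =>
    have h0 : ((X - C p) * (X - C q)) * derivative (bubblePow n p q)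
        = (n : ℝ[X]) * (2 * X - C p - C q) * bubblePow n p q := by
      rcases n with _ | n
      · simp [bubblePow]
      · simp only [bubblePow, derivative_pow, derivative_mul, derivative_sub, derivative_X,
          derivative_C]
        simp
        ring
    have h1 := congrArg derivative h0
    simp only [derivative_mul, derivative_sub, derivative_X, derivative_C, derivative_natCast,
      derivative_ofNat] at h1
    simp only [Function.iterate_succ_apply', Function.iterate_zero, id]
    push_cast
    linear_combination h1
  | succ m ih =>
    have h1 := congrArg derivative ih
    simp only [derivative_mul, derivative_sub, derivative_X, derivative_C, derivative_natCast,
      derivative_ofNat, derivative_add, derivative_one, ← Function.iterate_succ_apply'] at h1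
    simp only [Nat.succ_eq_add_one] at h1
    push_cast
    linear_combination h1

open Polynomial in
lemma eval_iterate_derivative_bubblePow_eq_zero {n j : ℕ} (hj : j < n) (p q : ℝ) :
    (derivative^[j] (bubblePow n p q)).eval p = 0 ∧
      (derivative^[j] (bubblePow n p q)).eval q = 0 := by
  obtain ⟨v, hv⟩ := pow_sub_dvd_iterate_derivative_pow ((X - C p) * (X - C q)) n j
  have h0 : n - j ≠ 0 := by omega
  rw [bubblePow, hv]
  constructor <;> simp [h0]

open Polynomial in
/-- At an interior root of the `(n+1)`-st derivative, the `(n-1)`-st derivative vanishes too. -/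
lemma eval_iterate_derivative_bubblePow_pred {n : ℕ} (p q s : ℝ)
    (hs : (derivative^[n + 2] (bubblePow (n + 1) p q)).eval s = 0) :
    (derivative^[n] (bubblePow (n + 1) p q)).eval s = 0 := by
  have h := congrArg (eval s) (bubblePow_derivative_identity (n + 1) n p q)
  simp only [eval_add, eval_mul, hs] at h
  simp only [eval_sub, eval_X, eval_C, eval_natCast, eval_one, eval_ofNat, mul_zero,
    zero_add, Nat.cast_add, Nat.cast_one, eval_add] at h
  have h2 : ((n : ℝ) + 1) * (n + 2) * (derivative^[n] (bubblePow (n + 1) p q)).eval s = 0 := by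
    linear_combination -h
  have h3 : ((n : ℝ) + 1) * (n + 2) ≠ 0 := by positivity
  exact (mul_eq_zero.1 h2).resolve_left h3

lemma integral_polynomial_derivative_mul (P Q : Polynomial ℝ) (p q : ℝ) :
    ∫ t in p..q, (Polynomial.derivative P).eval t * Q.eval t
      = P.eval q * Q.eval q - P.eval p * Q.eval p
        - ∫ t in p..q, P.eval t * (Polynomial.derivative Q).eval t := by
  have h := intervalIntegral.integral_mul_deriv_eq_deriv_mul (a := p) (b := q)
    (fun t _ => Q.hasDerivAt t) (fun t _ => P.hasDerivAt t)
    ((Polynomial.continuous _).intervalIntegrable _ _)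
    ((Polynomial.continuous _).intervalIntegrable _ _)
  simpa only [mul_comm] using h

open Polynomial in
lemma integral_iterate_derivative_bubblePow_mul {n : ℕ} (p q : ℝ) {j : ℕ} (hj : j ≤ n)
    (v : ℝ[X]) (hv : v.degree < j) :
    ∫ t in p..q, (derivative^[j] (bubblePow n p q)).eval t * v.eval t = 0 := by
  induction j generalizing v with
  | zero =>
    have : v = 0 := by simpa [Nat.WithBot.lt_zero_iff] using hv
    simp [this]
  | succ j ih =>
    obtain ⟨h1, h2⟩ := eval_iterate_derivative_bubblePow_eq_zero (by omega : j < n) p q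
    rw [Function.iterate_succ_apply', integral_polynomial_derivative_mul, h1, h2, ih (by omega)]
    · simp
    · rcases eq_or_ne v 0 with rfl | hv0
      · simp
      · have := degree_derivative_lt hv0
        refine this.trans_le ?_
        rw [degree_eq_natDegree hv0] at hv ⊢
        exact_mod_cast Nat.le_of_lt_succ (by exact_mod_cast hv)

open Polynomial in
lemma iteratedDeriv_eval (P : ℝ[X]) (j : ℕ) :
    iteratedDeriv j (fun t => P.eval t) = fun t => (derivative^[j] P).eval t := by
  induction j with
  | zero => simp
  | succ j ih =>
    rw [iteratedDeriv_succ, ih, Function.iterate_succ_apply']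
    ext t
    exact Polynomial.deriv _

open Polynomial in
lemma iterate_derivative_comp_affine (P : ℝ[X]) (m l : ℝ) (j : ℕ) :
    derivative^[j] (P.comp (C m + C l * X)) = C (l ^ j) * (derivative^[j] P).comp (C m + C l * X) := by
  induction j with
  | zero => simp
  | succ j ih =>
    rw [Function.iterate_succ_apply', ih, Function.iterate_succ_apply']
    rw [derivative_C_mul, derivative_comp, pow_succ, C_mul]
    simp only [derivative_add, derivative_C, derivative_C_mul, derivative_X]
    ring

open Polynomial in
/-- Roots of `L_n'` are mapped to roots of the `(n+1)`-st derivative of `bubblePow`. -/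
lemma eval_affMap_eq_zero_of_deriv_legendre {n : ℕ} {p q s : ℝ} (hpq : p < q)
    (hs : deriv (legendre n) s = 0) :
    (derivative^[n + 1] (bubblePow n p q)).eval (affMap p q s) = 0 := by
  have h1 : legendre n = fun t => (1 / ((2 : ℝ) ^ n * n.factorial)) *
      (derivative^[n] ((X ^ 2 - 1) ^ n : ℝ[X])).eval t := by
    ext t
    rw [← congrFun (iteratedDeriv_eval _ n) t]
    simp [legendre]
  rw [h1, deriv_const_mul _ (Polynomial.differentiableAt _), Polynomial.deriv,
    ← Function.iterate_succ_apply' (f := derivative)] at hs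
  have hroot := (mul_eq_zero.1 hs).resolve_left (by positivity)
  have hl : (q - p) / 2 ≠ 0 := by
    have := sub_pos.2 hpq
    positivity
  have hcomp : (bubblePow n p q).comp (C ((p + q) / 2) + C ((q - p) / 2) * X)
      = C ((((q - p) / 2) ^ 2) ^ n) * (X ^ 2 - 1) ^ n := by
    rw [bubblePow, pow_comp, C_pow, ← mul_pow]
    congr 1
    refine Polynomial.funext fun t => ?_
    simp
    ring
  have h2 := iterate_derivative_comp_affine (bubblePow n p q) ((p + q) / 2) ((q - p) / 2) (n + 1)
  rw [hcomp, iterate_derivative_C_mul] at h2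
  have h3 := congrArg (eval s) h2
  rw [eval_mul, eval_mul, hroot, mul_zero, eval_comp, eval_C] at h3
  have h4 := (mul_eq_zero.1 h3.symm).resolve_left (pow_ne_zero _ hl)
  rw [← h4]
  congr 1
  simp [affMap]
  ring

lemma abs_integral_le_of_abs_le {g : ℝ → ℝ} {p q R : ℝ}
    (hg : ∀ t ∈ Set.Icc p q, |g t| ≤ R) {t : ℝ} (ht : t ∈ Set.Icc p q) :
    |∫ s in p..t, g s| ≤ R * (q - p) := by
  have hR : 0 ≤ R := (abs_nonneg _).trans (hg t ht)
  have := norm_integral_le_of_norm_le_const (a := p) (b := t) (C := R) (f := g) (by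
    intro s hs
    rw [uIoc_of_le ht.1] at hs
    exact hg s ⟨hs.1.le, hs.2.trans ht.2⟩)
  rw [abs_of_nonneg (sub_nonneg.2 ht.1)] at this
  exact this.trans (mul_le_mul_of_nonneg_left (by linarith [ht.2]) hR)

lemma integral_integral_eq_zero {r : ℝ → ℝ} (hr : Continuous r) {p q : ℝ}
    (h0 : ∫ t in p..q, r t = 0) (h1 : ∫ t in p..q, r t * t = 0) :
    ∫ t in p..q, (∫ s in p..t, r s) = 0 := by
  have hd : ∀ t, HasDerivAt (fun t => ∫ s in p..t, r s) (r t) t := fun t =>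
    (hr.integral_hasStrictDerivAt p t).hasDerivAt
  have := intervalIntegral.integral_mul_deriv_eq_deriv_mul (a := p) (b := q)
    (fun t _ => hd t) (fun t _ => hasDerivAt_id t) (hr.intervalIntegrable _ _)
    (continuous_const.intervalIntegrable _ _)
  simpa [h0, h1] using this

open Polynomial in
/-- A residual `g - S` orthogonal to the polynomials of degree at most `n`, with `S` of degree at
most `n`, is controlled by the distance of `g` to polynomials, up to a multiple of the Legendre
polynomial of degree `n + 1` of the interval. -/
lemma exists_residual_bound (n : ℕ) : ∃ A > 0, ∀ p q : ℝ, p < q → ∀ (g : ℝ → ℝ) (S T : ℝ[X])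
    (D : ℝ), Continuous g → S.natDegree ≤ n →
    (∀ v : ℝ[X], v.natDegree ≤ n → ∫ t in p..q, (g t - S.eval t) * v.eval t = 0) →
    T.natDegree ≤ n + 1 → (∀ t ∈ Set.Icc p q, |g t - T.eval t| ≤ D) →
    ∃ κ : ℝ, (T.natDegree ≤ n → κ = 0) ∧ ∀ t ∈ Set.Icc p q,
      |g t - S.eval t - κ * (derivative^[n + 1] (bubblePow (n + 1) p q)).eval t| ≤ A * D := by
  obtain ⟨A, hA, hproj⟩ := exists_projection_bound n
  refine ⟨1 + A, by positivity, fun p q hpq g S T D hg hS horth hT hD => ?_⟩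
  set L := derivative^[n + 1] (bubblePow (n + 1) p q) with hL
  obtain ⟨hmonic, hdeg⟩ := monic_and_natDegree_bubblePow (n + 1) p q
  have hLdeg : L.natDegree ≤ n + 1 := by
    refine (natDegree_iterate_derivative _ _).trans ?_
    rw [hdeg]; omega
  have hLc : L.coeff (n + 1) ≠ 0 := by
    have h1 : (bubblePow (n + 1) p q).coeff (n + 1 + (n + 1)) = 1 := by
      rw [← two_mul, ← hdeg]; exact hmonic
    rw [hL, coeff_iterate_derivative, h1]
    simp [Nat.descFactorial_eq_zero_iff_lt]
    omega
  set κ := T.coeff (n + 1) / L.coeff (n + 1) with hκ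
  have hT' : (T - C κ * L).natDegree ≤ n := by
    rw [natDegree_le_iff_coeff_eq_zero]
    intro j hj
    rw [coeff_sub, coeff_C_mul]
    rcases (Nat.succ_le_of_lt hj).eq_or_lt with rfl | hj'
    · rw [hκ, Nat.succ_eq_add_one]; field_simp; ring
    · rw [coeff_eq_zero_of_natDegree_lt (hT.trans_lt hj'),
        coeff_eq_zero_of_natDegree_lt (hLdeg.trans_lt hj')]
      ring
  refine ⟨κ, fun h => ?_, fun t ht => ?_⟩
  · rw [hκ, coeff_eq_zero_of_natDegree_lt (Nat.lt_succ_of_le h), zero_div]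
  have hQ := hproj p q hpq (fun t => g t - T.eval t) (S - (T - C κ * L)) D
    (hg.sub T.continuous) ((natDegree_sub_le _ _).trans (max_le hS hT')) (by
      intro v hv
      have h1 : ∀ t, (g t - T.eval t - (S - (T - C κ * L)).eval t) * v.eval t
          = (g t - S.eval t) * v.eval t - κ * (L.eval t * v.eval t) := by
        intro t
        simp only [eval_sub, eval_mul, eval_C]
        ring
      simp only [h1]
      have hc1 : Continuous fun t => (g t - S.eval t) * v.eval t :=
        (hg.sub S.continuous).mul v.continuous
      have hc2 : Continuous fun t => κ * (L.eval t * v.eval t) :=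
        continuous_const.mul (L.continuous.mul v.continuous)
      rw [intervalIntegral.integral_sub (hc1.intervalIntegrable _ _)
        (hc2.intervalIntegrable _ _), horth v hv, intervalIntegral.integral_const_mul,
        integral_iterate_derivative_bubblePow_mul p q le_rfl v]
      · simp
      · exact degree_le_natDegree.trans_lt (by exact_mod_cast Nat.lt_succ_of_le hv)) hD t ht
  have h2 : g t - S.eval t - κ * L.eval t
      = (g t - T.eval t) - (S - (T - C κ * L)).eval t := by
    simp only [eval_sub, eval_mul, eval_C]
    ring
  rw [h2]
  calc _ ≤ _ := abs_sub _ _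
    _ ≤ D + A * D := add_le_add (hD t ht) hQ
    _ = _ := by ring

lemma IsPGSol.integral_residual_mul {k N : ℕ} {x : ℕ → ℝ} {α β γ : ℝ} {f : ℝ → ℝ}
    {P : ℕ → Polynomial ℝ} (hP : IsPGSol k N x α β γ f P) (hf : Continuous f) {i : ℕ}
    (hi : i ∈ Finset.Icc 1 N) {v : Polynomial ℝ} (hv : v.natDegree ≤ k - 2) :
    ∫ t in (x (i - 1))..(x i), (f t
      - (-α * ((Polynomial.derivative (Polynomial.derivative (P i))).eval t)
        + β * ((Polynomial.derivative (P i)).eval t) + γ * (P i).eval t)) * v.eval t = 0 := by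
  have h := hP.2 (Function.update 0 i v) (by
    intro j _
    rcases eq_or_ne j i with rfl | hji
    · simpa using hv
    · simp [hji])
  rw [Finset.sum_eq_single_of_mem i hi, Finset.sum_eq_single_of_mem i hi] at h
  · simp only [Function.update_self] at h
    simp only [sub_mul]
    have hc1 : Continuous fun t => f t * v.eval t := hf.mul v.continuous
    have hc2 : Continuous fun t =>
        (-α * ((Polynomial.derivative (Polynomial.derivative (P i))).eval t)
        + β * ((Polynomial.derivative (P i)).eval t) + γ * (P i).eval t) * v.eval t := by
      fun_prop
    rw [intervalIntegral.integral_sub (hc1.intervalIntegrable _ _)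
      (hc2.intervalIntegrable _ _), h, sub_self]
  · intro j _ hji
    simp [hji]
  · intro j _ hji
    simp [hji]

lemma abs_iteratedDeriv_le_of_mem_Icc {u : ℝ → ℝ} {a b M : ℝ} {m j : ℕ} (hab : a < b)
    (hu : ContDiff ℝ m u) (hj : j ≤ m) (hM : ∀ y ∈ Set.Ioo a b, |iteratedDeriv j u y| ≤ M) :
    ∀ y ∈ Set.Icc a b, |iteratedDeriv j u y| ≤ M := by
  have hc : IsClosed {y | |iteratedDeriv j u y| ≤ M} :=
    isClosed_le (hu.continuous_iteratedDeriv j (by exact_mod_cast hj)).abs continuous_const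
  intro y hy
  rw [← closure_Ioo hab.ne] at hy
  exact hc.closure_subset_iff.2 hM hy

lemma affMap_mem_Icc {p q s : ℝ} (hpq : p < q) (hs : s ∈ Set.Ioo (-1 : ℝ) 1) :
    affMap p q s ∈ Set.Icc p q := by
  unfold affMap
  constructor <;> nlinarith [hs.1, hs.2]

/-- Superconvergence of the derivative of the Petrov–Galerkin solution at the interior
Lobatto points (images of the roots of `L_{k-1}'`):
`|(u - u_h)'(gl_{in})| ≤ C h^{k+1} ‖u‖_{k+2,∞}`. -/
theorem petrov_galerkin_superconvergence_lobatto_points (k : ℕ) (hk : 3 ≤ k)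
    (α β γ c d : ℝ) (hα : 0 < α) (hγ : 0 ≤ γ) (hc : 1 ≤ c) (hd : 0 < d) :
    ∃ C > 0, ∃ h₀ > 0, ∀ (a b : ℝ), b - a = d →
      ∀ (N : ℕ) (x : ℕ → ℝ) (h : ℝ),
        IsMesh a b N x → IsMeshSize N x h → IsQuasiUniform N x h c → h ≤ h₀ →
      ∀ u : ℝ → ℝ, ContDiff ℝ (k + 2) u → u a = 0 → u b = 0 →
      ∀ P : ℕ → Polynomial ℝ,
        IsPGSol k N x α β γ (fun t => -α * iteratedDeriv 2 u t + β * deriv u t + γ * u t) P →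
      ∀ M : ℝ, (∀ j ≤ k + 2, ∀ y ∈ Set.Ioo a b, |iteratedDeriv j u y| ≤ M) →
        ∀ i ∈ Finset.Icc 1 N, ∀ s ∈ Set.Ioo (-1 : ℝ) 1, deriv (legendre (k - 1)) s = 0 →
          |deriv u (affMap (x (i - 1)) (x i) s)
              - (Polynomial.derivative (P i)).eval (affMap (x (i - 1)) (x i) s)|
            ≤ C * h ^ (k + 1) * M := by
  obtain ⟨n, rfl⟩ : ∃ n, k = n + 2 := ⟨k - 2, by omega⟩
  obtain ⟨Cs, hCs, hstab⟩ := exists_stability_const (β := β) hα hγ hd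
  obtain ⟨A, hA, hres⟩ := exists_residual_bound n
  obtain ⟨K, hK⟩ : ∃ y : ℝ, y = |β| * (1 / α + Cs) + γ * Cs := ⟨_, rfl⟩
  have hK0 : 0 ≤ K := by rw [hK]; positivity
  refine ⟨A * (α + K * (2 * A * α)) / α + Cs * (2 * A * α), by positivity,
    min 1 (1 / (2 * A * (K + 1))), by positivity, ?_⟩
  intro a b hab N x h hmesh hsize _ hh₀ u hu hua hub P hP M hM i₁ hi₁ s hs hroot
  obtain ⟨hN, hxa, hxb, hx⟩ := hmesh
  have hh1 : h ≤ 1 := hh₀.trans (min_le_left _ _)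
  have hAKh : A * K * h ≤ 1 / 2 := by
    have h1 : h * (2 * A * (K + 1)) ≤ 1 :=
      (le_div_iff₀ (by positivity)).1 (hh₀.trans (min_le_right _ _))
    have h2 : 0 < h := by
      have h3 := hsize.1 1 (Finset.mem_Icc.2 ⟨le_rfl, hN⟩)
      have h4 := hx 0 (by omega)
      simp only [Nat.sub_self] at h3
      linarith
    nlinarith [mul_pos hA h2]
  have hstep : ∀ i ∈ Finset.Icc 1 N, x (i - 1) < x i := by
    intro i hi
    obtain ⟨h1, h2⟩ := Finset.mem_Icc.1 hi
    have := hx (i - 1) (by omega)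
    rwa [Nat.sub_add_cancel h1] at this
  have hlen : ∀ i ∈ Finset.Icc 1 N, x i - x (i - 1) ≤ h := hsize.1
  have hh : 0 < h := by linarith [hstep i₁ hi₁, hlen i₁ hi₁]
  have hsub : ∀ i ∈ Finset.Icc 1 N, ∀ t ∈ Set.Icc (x (i - 1)) (x i), t ∈ Set.Icc a b := by
    intro i hi t ht
    obtain ⟨h1, h2⟩ := Finset.mem_Icc.1 hi
    have h3 := mesh_le_mesh hx (Nat.zero_le (i - 1)) (by omega)
    have h4 := mesh_le_mesh hx h2 le_rfl
    rw [hxa] at h3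
    rw [hxb] at h4
    exact ⟨h3.trans ht.1, ht.2.trans h4⟩
  have hu' : ContDiff ℝ ((n + 4 : ℕ)) u := by
    refine hu.of_le (le_of_eq ?_)
    push_cast
    rw [add_assoc]
    norm_num
  have hM' : ∀ j ≤ n + 4, ∀ y ∈ Set.Icc a b, |iteratedDeriv j u y| ≤ M := fun j hj =>
    abs_iteratedDeriv_le_of_mem_Icc (by linarith) hu' hj (hM j hj)
  have hM0 : 0 ≤ M := (abs_nonneg _).trans (hM' 0 (by omega) a ⟨le_rfl, by linarith⟩)
  have hu2 : ContDiff ℝ ((n + 2 : ℕ)) (iteratedDeriv 2 u) := by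
    rw [iteratedDeriv_eq_iterate]
    exact ContDiff.iterate_deriv' (n + 2) 2 hu'
  have hud : ∀ t, HasDerivAt u (deriv u t) t := fun t =>
    (hu'.differentiable (by simp) t).hasDerivAt
  have hud2 : ∀ t, HasDerivAt (deriv u) (iteratedDeriv 2 u t) t := fun t => by
    have h1 : Differentiable ℝ (iteratedDeriv 1 u) :=
      hu'.differentiable_iteratedDeriv 1 (by norm_cast; omega)
    rw [iteratedDeriv_one] at h1
    rw [iteratedDeriv_succ, iteratedDeriv_one]
    exact (h1 t).hasDerivAt
  have huc : Continuous u := hu'.continuous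
  have huc1 : Continuous (deriv u) := continuous_iff_continuousAt.2 fun t => (hud2 t).continuousAt
  have huc2 : Continuous (iteratedDeriv 2 u) := hu2.continuous
  set e : ℕ → ℝ → ℝ := fun i t => u t - (P i).eval t with he
  set e' : ℕ → ℝ → ℝ := fun i t => deriv u t - (Polynomial.derivative (P i)).eval t with he'
  set g : ℕ → ℝ → ℝ := fun i t => -α * iteratedDeriv 2 u t + (β * e' i t + γ * e i t) with hg
  set S : ℕ → Polynomial ℝ := fun i =>
    Polynomial.C (-α) * Polynomial.derivative (Polynomial.derivative (P i)) with hS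
  set r : ℕ → ℝ → ℝ := fun i t => g i t - (S i).eval t with hr
  set r₁ : ℕ → ℝ → ℝ := fun i t => ∫ s in x (i - 1)..t, r i s with hr₁
  set r₂ : ℕ → ℝ → ℝ := fun i t => ∫ s in x (i - 1)..t, r₁ i s with hr₂
  have hgc : ∀ i, Continuous (g i) := fun i => by
    simp only [hg, he, he']
    fun_prop
  have hrc : ∀ i, Continuous (r i) := fun i => (hgc i).sub (S i).continuous
  have hr₁d : ∀ i t, HasDerivAt (r₁ i) (r i t) t := fun i t =>
    ((hrc i).integral_hasStrictDerivAt _ t).hasDerivAt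
  have hr₁c : ∀ i, Continuous (r₁ i) := fun i =>
    continuous_iff_continuousAt.2 fun t => (hr₁d i t).continuousAt
  have hr₂d : ∀ i t, HasDerivAt (r₂ i) (r₁ i t) t := fun i t =>
    ((hr₁c i).integral_hasStrictDerivAt _ t).hasDerivAt
  have horth : ∀ i ∈ Finset.Icc 1 N, ∀ v : Polynomial ℝ, v.natDegree ≤ n →
      ∫ t in (x (i - 1))..(x i), r i t * v.eval t = 0 := by
    intro i hi v hv
    rw [← hP.integral_residual_mul (by fun_prop) hi (v := v) (by omega)]
    refine intervalIntegral.integral_congr fun t _ => ?_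
    simp only [hr, hg, hS, he, he', Polynomial.eval_mul, Polynomial.eval_C]
    ring
  have hSdeg : ∀ i ∈ Finset.Icc 1 N, (S i).natDegree ≤ n := by
    intro i hi
    have h1 := Polynomial.natDegree_derivative_le (P i)
    have h2 := Polynomial.natDegree_derivative_le (Polynomial.derivative (P i))
    have h3 := hP.1.1 i hi
    exact (Polynomial.natDegree_C_mul_le _ _).trans (by omega)
  obtain ⟨R, hR0, hR, i₀, hi₀, t₀, ht₀, hRt₀⟩ : ∃ R : ℝ, 0 ≤ R ∧
      (∀ i ∈ Finset.Icc 1 N, ∀ t ∈ Set.Icc (x (i - 1)) (x i), |r i t| ≤ R) ∧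
      ∃ i ∈ Finset.Icc 1 N, ∃ t ∈ Set.Icc (x (i - 1)) (x i), |r i t| = R := by
    have hmax : ∀ i, ∃ t, i ∈ Finset.Icc 1 N → t ∈ Set.Icc (x (i - 1)) (x i) ∧
        ∀ s ∈ Set.Icc (x (i - 1)) (x i), |r i s| ≤ |r i t| := by
      intro i
      by_cases hi : i ∈ Finset.Icc 1 N
      · obtain ⟨t, ht, hmax⟩ := isCompact_Icc.exists_isMaxOn
          (Set.nonempty_Icc.2 (hstep i hi).le) (hrc i).abs.continuousOn
        exact ⟨t, fun _ => ⟨ht, fun s hs => hmax hs⟩⟩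
      · exact ⟨0, fun h => absurd h hi⟩
    choose τ hτ using hmax
    obtain ⟨i₀, hi₀, hmax⟩ := Finset.exists_max_image (Finset.Icc 1 N) (fun i => |r i (τ i)|)
      ⟨i₁, hi₁⟩
    exact ⟨|r i₀ (τ i₀)|, abs_nonneg _, fun i hi t ht => ((hτ i hi).2 t ht).trans (hmax i hi),
      i₀, hi₀, τ i₀, (hτ i₀ hi₀).1, rfl⟩
  have hr₁R : ∀ i ∈ Finset.Icc 1 N, ∀ t ∈ Set.Icc (x (i - 1)) (x i), |r₁ i t| ≤ R * h :=
    fun i hi t ht => (abs_integral_le_of_abs_le (hR i hi) ht).trans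
      (mul_le_mul_of_nonneg_left (hlen i hi) hR0)
  have hr₂R : ∀ i ∈ Finset.Icc 1 N, ∀ t ∈ Set.Icc (x (i - 1)) (x i), |r₂ i t| ≤ R * h * h :=
    fun i hi t ht => (abs_integral_le_of_abs_le (hr₁R i hi) ht).trans
      (mul_le_mul_of_nonneg_left (hlen i hi) (by positivity))
  have hglue := hstab N x hN (by rw [hxa, hxb, hab]) hx e e' r r₁ r₂ (R * h * h)
    (fun i t => (hud t).sub ((P i).hasDerivAt t))
    (fun i t => by
      refine ((hud2 t).sub ((Polynomial.derivative (P i)).hasDerivAt t)).congr_deriv ?_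
      simp only [hr, hg, hS, Polynomial.eval_mul, Polynomial.eval_C]
      field_simp
      ring)
    hr₁d hr₂d
    (fun i hi => by
      have h0 : ∫ t in (x (i - 1))..(x i), r i t = 0 := by
        simpa using horth i hi 1 (by simp)
      have h1 : ∫ t in (x (i - 1))..(x i), r i t * t = 0 := by
        simpa using horth i hi Polynomial.X (by rw [Polynomial.natDegree_X]; omega)
      exact ⟨intervalIntegral.integral_same, h0, intervalIntegral.integral_same,
        integral_integral_eq_zero (hrc i) h0 h1⟩)
    (fun i hi => by simp only [he, hP.1.2.1 i hi])
    (fun i hi => by simp only [he', hP.1.2.2.1 i hi])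
    (by simp only [he]; rw [hP.1.2.2.2.1, hxa, hua, sub_zero])
    (by simp only [he]; rw [hP.1.2.2.2.2, hxb, hub, sub_zero])
    hr₂R
  have hlow : ∀ i ∈ Finset.Icc 1 N, ∀ t ∈ Set.Icc (x (i - 1)) (x i),
      |β * e' i t + γ * e i t| ≤ K * (R * h) := by
    intro i hi t ht
    obtain ⟨h1, h2⟩ := hglue i hi t ht
    have h3 : R * h * h ≤ R * h := mul_le_of_le_one_right (by positivity) hh1
    have h4 : |e i t| ≤ Cs * (R * h) := h1.trans (mul_le_mul_of_nonneg_left h3 hCs.le)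
    have h5 : |e' i t| ≤ (1 / α + Cs) * (R * h) := by
      have h6 := abs_sub (e' i t + r₁ i t / α) (r₁ i t / α)
      rw [add_sub_cancel_right, abs_div, abs_of_pos hα] at h6
      calc |e' i t| ≤ _ := h6
        _ ≤ Cs * (R * h) + R * h / α := by
            gcongr
            · exact h2.trans (mul_le_mul_of_nonneg_left h3 hCs.le)
            · exact hr₁R i hi t ht
        _ = _ := by ring
    calc _ ≤ |β| * |e' i t| + γ * |e i t| := by
          refine (abs_add_le _ _).trans ?_
          rw [abs_mul, abs_mul, abs_of_nonneg hγ]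
      _ ≤ |β| * ((1 / α + Cs) * (R * h)) + γ * (Cs * (R * h)) := by gcongr
      _ = _ := by rw [hK]; ring
  have happrox : ∀ m ≤ n + 1, ∀ i ∈ Finset.Icc 1 N, ∃ T : Polynomial ℝ, T.natDegree ≤ m ∧
      ∀ t ∈ Set.Icc (x (i - 1)) (x i),
        |g i t - T.eval t| ≤ α * (M * h ^ (m + 1)) + K * (R * h) := by
    intro m hm i hi
    obtain ⟨T, hT, hTb⟩ := exists_taylor_polynomial (f := iteratedDeriv 2 u) (n := m) (M := M)
      (hstep i hi) (hu2.of_le (by norm_cast; omega)) (by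
        intro y hy
        have h1 := hM' (m + 1 + 2) (by omega) y (hsub i hi y hy)
        rwa [iteratedDeriv_eq_iterate, Function.iterate_add_apply, ← iteratedDeriv_eq_iterate,
          ← iteratedDeriv_eq_iterate] at h1)
    refine ⟨Polynomial.C (-α) * T, (Polynomial.natDegree_C_mul_le _ _).trans hT, fun t ht => ?_⟩
    have h1 : g i t - (Polynomial.C (-α) * T).eval t
        = -(α * (iteratedDeriv 2 u t - T.eval t)) + (β * e' i t + γ * e i t) := by
      simp only [hg, Polynomial.eval_mul, Polynomial.eval_C]
      ring
    rw [h1]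
    refine (abs_add_le _ _).trans (add_le_add ?_ (hlow i hi t ht))
    rw [abs_neg, abs_mul, abs_of_pos hα]
    refine mul_le_mul_of_nonneg_left ((hTb t ht).trans ?_) hα.le
    have := (sub_pos.2 (hstep i hi)).le
    gcongr
    exact hlen i hi
  have hRle : R ≤ 2 * A * α * (M * h ^ (n + 1)) := by
    obtain ⟨T, hT, hTb⟩ := happrox n (by omega) i₀ hi₀
    obtain ⟨κ, hκ, hb⟩ := hres _ _ (hstep i₀ hi₀) (g i₀) (S i₀) T _ (hgc i₀) (hSdeg i₀ hi₀)
      (horth i₀ hi₀) (by omega) hTb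
    have h1 := hb t₀ ht₀
    rw [hκ hT, zero_mul, sub_zero] at h1
    change |r i₀ t₀| ≤ _ at h1
    rw [hRt₀] at h1
    have h2 : A * K * h * R ≤ 1 / 2 * R := mul_le_mul_of_nonneg_right hAKh hR0
    linarith
  obtain ⟨T, hT, hTb⟩ := happrox (n + 1) le_rfl i₁ hi₁
  obtain ⟨κ, -, hb⟩ := hres _ _ (hstep i₁ hi₁) (g i₁) (S i₁) T _ (hgc i₁) (hSdeg i₁ hi₁)
    (horth i₁ hi₁) hT hTb
  set z := affMap (x (i₁ - 1)) (x i₁) s with hz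
  have hzmem : z ∈ Set.Icc (x (i₁ - 1)) (x i₁) := affMap_mem_Icc (hstep i₁ hi₁) hs
  set L := Polynomial.derivative^[n + 1] (bubblePow (n + 1) (x (i₁ - 1)) (x i₁)) with hL
  have hLint : ∫ t in (x (i₁ - 1))..z, L.eval t = 0 := by
    have h1 := integral_polynomial_derivative_mul
      (Polynomial.derivative^[n] (bubblePow (n + 1) (x (i₁ - 1)) (x i₁))) 1 (x (i₁ - 1)) z
    rw [← Function.iterate_succ_apply' (f := Polynomial.derivative),
      (eval_iterate_derivative_bubblePow_eq_zero (Nat.lt_succ_self n) _ _).1,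
      eval_iterate_derivative_bubblePow_pred _ _ _
        (eval_affMap_eq_zero_of_deriv_legendre (hstep i₁ hi₁) hroot)] at h1
    simp only [Polynomial.eval_one, Polynomial.derivative_one, Polynomial.eval_zero, mul_one, mul_zero,
      sub_zero, intervalIntegral.integral_zero] at h1
    exact h1
  have hr₁z : |r₁ i₁ z| ≤ A * (α + K * (2 * A * α)) * (h ^ (n + 3) * M) := by
    have h1 : r₁ i₁ z = ∫ t in (x (i₁ - 1))..z, (g i₁ t - (S i₁).eval t - κ * L.eval t) := by
      have hc : Continuous fun t => κ * L.eval t := continuous_const.mul L.continuous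
      rw [intervalIntegral.integral_sub ((hrc i₁).intervalIntegrable _ _)
        (hc.intervalIntegrable _ _), intervalIntegral.integral_const_mul, hLint, mul_zero,
        sub_zero]
    rw [h1]
    refine (abs_integral_le_of_abs_le hb hzmem).trans ?_
    calc _ ≤ A * (α * (M * h ^ (n + 1 + 1)) + K * (2 * A * α * (M * h ^ (n + 1)) * h)) * h := by
          have := (sub_pos.2 (hstep i₁ hi₁)).le
          gcongr
          exact hlen i₁ hi₁
      _ = _ := by ring
  have hfin := (hglue i₁ hi₁ z hzmem).2
  change |e' i₁ z| ≤ _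
  have h6 := abs_sub (e' i₁ z + r₁ i₁ z / α) (r₁ i₁ z / α)
  rw [add_sub_cancel_right, abs_div, abs_of_pos hα] at h6
  calc |e' i₁ z| ≤ _ := h6
    _ ≤ Cs * (2 * A * α * (M * h ^ (n + 1)) * h * h)
        + A * (α + K * (2 * A * α)) * (h ^ (n + 3) * M) / α := by
        gcongr
        exact hfin.trans (by gcongr)
    _ = _ := by ring
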